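/- The 9×9 trigonometric osp(1|2) classical r-matrix r(λ) satisfies the classical Yang–Baxter equation [r₁₂(λ−μ), r₁₃(λ−ν) + r₂₃(μ−ν)] + [r₁₃(λ−ν), r₂₃(μ−ν)] = 0 as an identity of 27×27 matrices on C³⊗C³⊗C³, for all complex λ, μ, ν such that the relevant sinh factors are nonzero, where the subscripts indicate on which two tensor factors r acts (with graded embedding signs determined by the grading p(1)=p(3)=0, p(2)=1). -/

import Mathlib

open Matrix

/-- The 9×9 matrix form of the trigonometric osp(1|2) classical r-matrix. -/
noncomputable def ospTrigR (lam : ℂ) : Matrix (Fin 9) (Fin 9) ℂ :=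
  let ct := Complex.cosh lam / Complex.sinh lam
  let em := Complex.exp (-lam) / Complex.sinh lam
  let ep := Complex.exp lam / Complex.sinh lam
  !![ct, 0, 0, 0, 0, 0, 0, 0, 0;
     0, 0, 0, em, 0, 0, 0, 0, 0;
     0, 0, -ct, 0, -em, 0, 2 * em, 0, 0;
     0, ep, 0, 0, 0, 0, 0, 0, 0;
     0, 0, ep, 0, 0, 0, -em, 0, 0;
     0, 0, 0, 0, 0, 0, 0, em, 0;
     0, 0, 2 * ep, 0, ep, 0, -ct, 0, 0;
     0, 0, 0, 0, 0, ep, 0, 0, 0;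
     0, 0, 0, 0, 0, 0, 0, 0, ct]

/-- The grading: `p(0) = p(2) = 0`, `p(1) = 1` (0-based indices of the basis of ℂ³). -/
def ospGrading (n : ℕ) : ℕ := if n = 1 then 1 else 0

/-- `r₁₂ = r ⊗ I` acting on `ℂ³⊗ℂ³⊗ℂ³ ≅ ℂ²⁷`; index `i` decomposes as
`(i/9, i/3 % 3, i % 3)`. -/
noncomputable def ospR12 (lam : ℂ) : Matrix (Fin 27) (Fin 27) ℂ :=
  Matrix.of fun i j =>
    if (i : ℕ) % 3 = (j : ℕ) % 3 then
      ospTrigR lam ⟨(i : ℕ) / 3, by omega⟩ ⟨(j : ℕ) / 3, by omega⟩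
    else 0

/-- `r₂₃ = I ⊗ r` (no extra sign since `r` is an even element). -/
noncomputable def ospR23 (lam : ℂ) : Matrix (Fin 27) (Fin 27) ℂ :=
  Matrix.of fun i j =>
    if (i : ℕ) / 9 = (j : ℕ) / 9 then
      ospTrigR lam ⟨(i : ℕ) % 9, by omega⟩ ⟨(j : ℕ) % 9, by omega⟩
    else 0

/-- `r₁₃`, acting on the first and third tensor factors, with the graded sign
`(−1)^{p(b)(p(c)+p(f))}` coming from moving the second leg of `r` past the
middle factor. -/
noncomputable def ospR13 (lam : ℂ) : Matrix (Fin 27) (Fin 27) ℂ :=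
  Matrix.of fun i j =>
    if (i : ℕ) / 3 % 3 = (j : ℕ) / 3 % 3 then
      ((-1 : ℂ) ^ (ospGrading ((i : ℕ) / 3 % 3) *
          (ospGrading ((i : ℕ) % 3) + ospGrading ((j : ℕ) % 3)))) *
        ospTrigR lam ⟨(i : ℕ) / 9 * 3 + (i : ℕ) % 3, by omega⟩
          ⟨(j : ℕ) / 9 * 3 + (j : ℕ) % 3, by omega⟩
    else 0

/-- Coefficient of `coth` in the `9×9` r-matrix. -/
def coefA (i j : ℕ) : ℤ :=
  match i * 9 + j with
  | 0 => 1 | 12 => 1 | 20 => -1 | 22 => -1 | 24 => 2 | 28 => 1 | 38 => 1 | 42 => -1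
  | 52 => 1 | 56 => 2 | 58 => 1 | 60 => -1 | 68 => 1 | 80 => 1 | _ => 0

/-- Constant term in the `9×9` r-matrix. -/
def coefB (i j : ℕ) : ℤ :=
  match i * 9 + j with
  | 12 => -1 | 22 => 1 | 24 => -2 | 28 => 1 | 38 => 1 | 42 => 1
  | 52 => -1 | 56 => 2 | 58 => 1 | 68 => 1 | _ => 0

/-- Embedding in factors 1, 2. -/
def emb12 (f : ℕ → ℕ → ℤ) (i j : ℕ) : ℤ :=
  bif Nat.beq (i % 3) (j % 3) then f (i / 3) (j / 3) else 0

/-- Embedding in factors 2, 3. -/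
def emb23 (f : ℕ → ℕ → ℤ) (i j : ℕ) : ℤ :=
  bif Nat.beq (i / 9) (j / 9) then f (i % 9) (j % 9) else 0

/-- Graded sign. -/
def embSign (b c f : ℕ) : ℤ :=
  bif Nat.beq b 1 && (Nat.beq c 1 ^^ Nat.beq f 1) then -1 else 1

/-- Graded embedding in factors 1, 3. -/
def emb13 (f : ℕ → ℕ → ℤ) (i j : ℕ) : ℤ :=
  bif Nat.beq (i / 3 % 3) (j / 3 % 3) then
    embSign (i / 3 % 3) (i % 3) (j % 3) * f (i / 9 * 3 + i % 3) (j / 9 * 3 + j % 3)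
  else 0

/-- All of the first `n` values are `true`. -/
def ball : ℕ → (ℕ → Bool) → Bool
  | 0, _ => true
  | n + 1, p => ball n p && p n

theorem ball_spec (n : ℕ) (p : ℕ → Bool) (h : ball n p = true) (i : ℕ) (hi : i < n) :
    p i = true := by
  induction n with
  | zero => omega
  | succ n ih =>
    simp only [ball, Bool.and_eq_true] at h
    rcases Nat.lt_succ_iff_lt_or_eq.mp hi with h1 | h1
    · exact ih h.1 h1
    · exact h1 ▸ h.2

/-- Sparse rows of `coefA`. -/
def rowA : ℕ → List (ℕ × ℤ)
  | 0 => [(0, 1)]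
  | 1 => [(3, 1)]
  | 2 => [(2, -1), (4, -1), (6, 2)]
  | 3 => [(1, 1)]
  | 4 => [(2, 1), (6, -1)]
  | 5 => [(7, 1)]
  | 6 => [(2, 2), (4, 1), (6, -1)]
  | 7 => [(5, 1)]
  | 8 => [(8, 1)]
  | _ => []

/-- Sparse rows of `coefB`. -/
def rowB : ℕ → List (ℕ × ℤ)
  | 0 => []
  | 1 => [(3, -1)]
  | 2 => [(4, 1), (6, -2)]
  | 3 => [(1, 1)]
  | 4 => [(2, 1), (6, 1)]
  | 5 => [(7, -1)]
  | 6 => [(2, 2), (4, 1)]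
  | 7 => [(5, 1)]
  | 8 => []
  | _ => []

/-- Entry of a sparse row. -/
def coef : List (ℕ × ℤ) → ℕ → ℤ
  | [], _ => 0
  | e :: L, j => bif Nat.beq e.1 j then e.2 + coef L j else coef L j

/-- Sparse rows of the embedding in factors 1, 2. -/
def sp12 (r : ℕ → List (ℕ × ℤ)) (i : ℕ) : List (ℕ × ℤ) :=
  (r (i / 3)).map fun e => (e.1 * 3 + i % 3, e.2)

/-- Sparse rows of the embedding in factors 2, 3. -/
def sp23 (r : ℕ → List (ℕ × ℤ)) (i : ℕ) : List (ℕ × ℤ) :=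
  (r (i % 9)).map fun e => (i / 9 * 9 + e.1, e.2)

/-- Sparse rows of the graded embedding in factors 1, 3. -/
def sp13 (r : ℕ → List (ℕ × ℤ)) (i : ℕ) : List (ℕ × ℤ) :=
  (r (i / 9 * 3 + i % 3)).map fun e =>
    (e.1 / 3 * 9 + i / 3 % 3 * 3 + e.1 % 3, embSign (i / 3 % 3) (i % 3) (e.1 % 3) * e.2)

/-- Entry of a row times a matrix. -/
def mulc (G : ℕ → List (ℕ × ℤ)) (j : ℕ) : List (ℕ × ℤ) → ℤ
  | [] => 0
  | e :: L => e.2 * coef (G e.1) j + mulc G j L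

/-- All column indices are in range. -/
def keysOk : List (ℕ × ℤ) → Bool
  | [] => true
  | e :: L => Nat.ble (e.1 + 1) 27 && keysOk L

theorem natBeq_false {m n : ℕ} (h : ¬ m = n) : Nat.beq m n = false := by
  cases e : Nat.beq m n
  · rfl
  · exact absurd (Nat.eq_of_beq_eq_true e) h

theorem mulc_eq (G : ℕ → List (ℕ × ℤ)) (j : ℕ) (L : List (ℕ × ℤ)) (h : keysOk L = true) :
    mulc G j L = ∑ k ∈ Finset.range 27, coef L k * coef (G k) j := by
  induction L with
  | nil => simp [mulc, coef]
  | cons e L ih =>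
    simp only [keysOk, Bool.and_eq_true] at h
    have hk : e.1 < 27 := Nat.le_of_ble_eq_true h.1
    have hc : ∀ k, coef (e :: L) k = (if e.1 = k then e.2 else 0) + coef L k := by
      intro k
      by_cases hh : e.1 = k
      · simp [coef, hh]
      · simp [coef, hh, natBeq_false hh]
    simp only [mulc, hc, add_mul, Finset.sum_add_distrib, ← ih h.2, ite_mul, zero_mul,
      Finset.sum_ite_eq, Finset.mem_range, hk, if_true]

/-- Entry of a commutator. -/
def comEntry (F G : ℕ → List (ℕ × ℤ)) (i j : ℕ) : ℤ :=
  mulc G j (F i) - mulc F j (G i)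

/-- All rows have their column indices in range. -/
def rowsOk (F : ℕ → List (ℕ × ℤ)) : Bool := ball 27 fun i => keysOk (F i)

/-- The complex matrix of a family of sparse rows. -/
noncomputable def toM (F : ℕ → List (ℕ × ℤ)) : Matrix (Fin 27) (Fin 27) ℂ :=
  Matrix.of fun i j => (coef (F i) j : ℂ)

theorem com_apply (F G : ℕ → List (ℕ × ℤ)) (hF : rowsOk F = true) (hG : rowsOk G = true)
    (i j : Fin 27) :
    (toM F * toM G - toM G * toM F) i j = (comEntry F G i j : ℂ) := by
  rw [comEntry, mulc_eq G j (F i) (ball_spec 27 _ hF i i.2),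
    mulc_eq F j (G i) (ball_spec 27 _ hG i i.2)]
  simp [Finset.sum_range, toM, Matrix.mul_apply]

theorem checkEntries (E : ℕ → ℕ → ℤ)
    (h : (ball 27 fun i => ball 27 fun j => decide (E i j = 0)) = true) (i j : Fin 27) :
    E i j = 0 :=
  of_decide_eq_true (ball_spec 27 _ (ball_spec 27 _ h i i.2) j j.2)

theorem com_two (F G F1 G1 : ℕ → List (ℕ × ℤ))
    (hF : rowsOk F = true) (hG : rowsOk G = true) (hF1 : rowsOk F1 = true) (hG1 : rowsOk G1 = true)
    (h : (ball 27 fun i => ball 27 fun j =>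
      decide (comEntry F G i j + comEntry F1 G1 i j = 0)) = true) :
    (toM F * toM G - toM G * toM F) + (toM F1 * toM G1 - toM G1 * toM F1) = 0 := by
  ext i j
  rw [Matrix.add_apply, com_apply F G hF hG, com_apply F1 G1 hF1 hG1]
  have := checkEntries (fun i j => comEntry F G i j + comEntry F1 G1 i j) h i j
  simpa using (by exact_mod_cast this :
    (comEntry F G i j : ℂ) + (comEntry F1 G1 i j : ℂ) = 0)

theorem com_four (F G F1 G1 F2 G2 F3 G3 : ℕ → List (ℕ × ℤ))
    (hF : rowsOk F = true) (hG : rowsOk G = true) (hF1 : rowsOk F1 = true) (hG1 : rowsOk G1 = true)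
    (hF2 : rowsOk F2 = true) (hG2 : rowsOk G2 = true)
    (hF3 : rowsOk F3 = true) (hG3 : rowsOk G3 = true)
    (h : (ball 27 fun i => ball 27 fun j =>
      decide (comEntry F G i j + comEntry F1 G1 i j + comEntry F2 G2 i j
        + comEntry F3 G3 i j = 0)) = true) :
    (toM F * toM G - toM G * toM F) + (toM F1 * toM G1 - toM G1 * toM F1)
      + (toM F2 * toM G2 - toM G2 * toM F2) + (toM F3 * toM G3 - toM G3 * toM F3) = 0 := by
  ext i j
  rw [Matrix.add_apply, Matrix.add_apply, Matrix.add_apply,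
    com_apply F G hF hG, com_apply F1 G1 hF1 hG1, com_apply F2 G2 hF2 hG2,
    com_apply F3 G3 hF3 hG3]
  have := checkEntries (fun i j => comEntry F G i j + comEntry F1 G1 i j + comEntry F2 G2 i j
        + comEntry F3 G3 i j) h i j
  simpa using (by exact_mod_cast this :
    (comEntry F G i j : ℂ) + (comEntry F1 G1 i j : ℂ) + (comEntry F2 G2 i j : ℂ)
      + (comEntry F3 G3 i j : ℂ) = 0)

theorem agree (E : ℕ → ℕ → ℤ) (F : ℕ → List (ℕ × ℤ))
    (h : (ball 27 fun i => ball 27 fun j => decide (coef (F i) j - E i j = 0)) = true) :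
    toM F = Matrix.of fun (i j : Fin 27) => (E i j : ℂ) := by
  ext i j
  have := checkEntries (fun i j => coef (F i) j - E i j) h i j
  simp only [toM, Matrix.of_apply]
  exact_mod_cast sub_eq_zero.mp this

theorem ok12A : rowsOk (sp12 rowA) = true := by decide +kernel

theorem ok12B : rowsOk (sp12 rowB) = true := by decide +kernel

theorem ok13A : rowsOk (sp13 rowA) = true := by decide +kernel

theorem ok13B : rowsOk (sp13 rowB) = true := by decide +kernel

theorem ok23A : rowsOk (sp23 rowA) = true := by decide +kernel

theorem ok23B : rowsOk (sp23 rowB) = true := by decide +kernel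

theorem idXZ :
    (toM (sp12 rowA) * toM (sp13 rowA) - toM (sp13 rowA) * toM (sp12 rowA))
      + (toM (sp12 rowA) * toM (sp23 rowA) - toM (sp23 rowA) * toM (sp12 rowA)) = 0 :=
  com_two _ _ _ _
    ok12A ok13A ok12A ok23A
    (by decide +kernel)

theorem idYZ :
    (toM (sp12 rowA) * toM (sp23 rowA) - toM (sp23 rowA) * toM (sp12 rowA))
      + (toM (sp13 rowA) * toM (sp23 rowA) - toM (sp23 rowA) * toM (sp13 rowA)) = 0 :=
  com_two _ _ _ _
    ok12A ok23A ok13A ok23A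
    (by decide +kernel)

theorem idX :
    (toM (sp12 rowA) * toM (sp13 rowB) - toM (sp13 rowB) * toM (sp12 rowA))
      + (toM (sp12 rowA) * toM (sp23 rowB) - toM (sp23 rowB) * toM (sp12 rowA)) = 0 :=
  com_two _ _ _ _
    ok12A ok13B ok12A ok23B
    (by decide +kernel)

theorem idY :
    (toM (sp12 rowB) * toM (sp13 rowA) - toM (sp13 rowA) * toM (sp12 rowB))
      + (toM (sp13 rowA) * toM (sp23 rowB) - toM (sp23 rowB) * toM (sp13 rowA)) = 0 :=
  com_two _ _ _ _
    ok12B ok13A ok13A ok23B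
    (by decide +kernel)

theorem idZ :
    (toM (sp12 rowB) * toM (sp23 rowA) - toM (sp23 rowA) * toM (sp12 rowB))
      + (toM (sp13 rowB) * toM (sp23 rowA) - toM (sp23 rowA) * toM (sp13 rowB)) = 0 :=
  com_two _ _ _ _
    ok12B ok23A ok13B ok23A
    (by decide +kernel)

theorem idC :
    (toM (sp12 rowB) * toM (sp13 rowB) - toM (sp13 rowB) * toM (sp12 rowB))
      + (toM (sp12 rowB) * toM (sp23 rowB) - toM (sp23 rowB) * toM (sp12 rowB))
      + (toM (sp13 rowB) * toM (sp23 rowB) - toM (sp23 rowB) * toM (sp13 rowB))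
      + (toM (sp12 rowA) * toM (sp13 rowA) - toM (sp13 rowA) * toM (sp12 rowA)) = 0 :=
  com_four _ _ _ _ _ _ _ _
    ok12B ok13B ok12B ok23B ok13B ok23B ok12A ok13A
    (by decide +kernel)

/-- The hyperbolic cotangent. -/
noncomputable def cth (l : ℂ) : ℂ := Complex.cosh l / Complex.sinh l

theorem em_eq (l : ℂ) (h : Complex.sinh l ≠ 0) :
    Complex.exp (-l) / Complex.sinh l = cth l - 1 := by
  rw [cth, ← Complex.cosh_sub_sinh]; field_simp

theorem ep_eq (l : ℂ) (h : Complex.sinh l ≠ 0) :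
    Complex.exp l / Complex.sinh l = cth l + 1 := by
  rw [cth, ← Complex.cosh_add_sinh]; field_simp

theorem trigR_eq (l : ℂ) (h : Complex.sinh l ≠ 0) (i j : Fin 9) :
    ospTrigR l i j = cth l * (coefA i j : ℂ) + (coefB i j : ℂ) := by
  simp only [ospTrigR, em_eq l h, ep_eq l h]
  rw [← cth]
  generalize cth l = c
  fin_cases i <;> fin_cases j <;> simp [coefA, coefB] <;> ring

theorem r12_eq (l : ℂ) (h : Complex.sinh l ≠ 0) :
    ospR12 l = cth l • toM (sp12 rowA) + toM (sp12 rowB) := by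
  rw [agree (emb12 coefA) (sp12 rowA) (by decide +kernel),
    agree (emb12 coefB) (sp12 rowB) (by decide +kernel)]
  ext i j
  simp only [ospR12, Matrix.of_apply, trigR_eq l h, emb12, Matrix.add_apply,
    Matrix.smul_apply, smul_eq_mul]
  by_cases e : (i : ℕ) % 3 = (j : ℕ) % 3
  · simp [e]
  · simp [e, natBeq_false e]

theorem r23_eq (l : ℂ) (h : Complex.sinh l ≠ 0) :
    ospR23 l = cth l • toM (sp23 rowA) + toM (sp23 rowB) := by
  rw [agree (emb23 coefA) (sp23 rowA) (by decide +kernel),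
    agree (emb23 coefB) (sp23 rowB) (by decide +kernel)]
  ext i j
  simp only [ospR23, Matrix.of_apply, trigR_eq l h, emb23, Matrix.add_apply,
    Matrix.smul_apply, smul_eq_mul]
  by_cases e : (i : ℕ) / 9 = (j : ℕ) / 9
  · simp [e]
  · simp [e, natBeq_false e]

theorem sign_eq (b c f : ℕ) :
    (-1 : ℂ) ^ (ospGrading b * (ospGrading c + ospGrading f)) = (embSign b c f : ℂ) := by
  unfold ospGrading embSign
  by_cases hb : b = 1 <;> by_cases hc : c = 1 <;> by_cases hf : f = 1 <;>
    simp [hb, hc, hf, natBeq_false]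

theorem r13_eq (l : ℂ) (h : Complex.sinh l ≠ 0) :
    ospR13 l = cth l • toM (sp13 rowA) + toM (sp13 rowB) := by
  rw [agree (emb13 coefA) (sp13 rowA) (by decide +kernel),
    agree (emb13 coefB) (sp13 rowB) (by decide +kernel)]
  ext i j
  simp only [ospR13, Matrix.of_apply, trigR_eq l h, emb13, Matrix.add_apply,
    Matrix.smul_apply, smul_eq_mul, sign_eq]
  by_cases e : (i : ℕ) / 3 % 3 = (j : ℕ) / 3 % 3
  · simp [e]; ring
  · simp [e, natBeq_false e]

theorem cth_rel (a b : ℂ) (ha : Complex.sinh a ≠ 0) (hb : Complex.sinh b ≠ 0)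
    (hab : Complex.sinh (a + b) ≠ 0) :
    cth (a + b) * (cth a + cth b) = 1 + cth a * cth b := by
  unfold cth
  field_simp
  rw [Complex.sinh_add, Complex.cosh_add]
  ring

/-- The trigonometric osp(1|2) classical r-matrix satisfies the classical
Yang–Baxter equation
`[r₁₂(λ−μ), r₁₃(λ−ν) + r₂₃(μ−ν)] + [r₁₃(λ−ν), r₂₃(μ−ν)] = 0`. -/
theorem osp12_trig_classical_yang_baxter
    (lam mu nu : ℂ)
    (h12 : Complex.sinh (lam - mu) ≠ 0)
    (h13 : Complex.sinh (lam - nu) ≠ 0)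
    (h23 : Complex.sinh (mu - nu) ≠ 0) :
    (ospR12 (lam - mu) * (ospR13 (lam - nu) + ospR23 (mu - nu))
        - (ospR13 (lam - nu) + ospR23 (mu - nu)) * ospR12 (lam - mu))
      + (ospR13 (lam - nu) * ospR23 (mu - nu)
        - ospR23 (mu - nu) * ospR13 (lam - nu)) = 0 := by
  have rel := cth_rel (lam - mu) (mu - nu) h12 h23 (by simpa using h13)
  rw [sub_add_sub_cancel] at rel
  rw [r12_eq _ h12, r13_eq _ h13, r23_eq _ h23]
  have e1 := idXZ
  have e2 := idYZ
  have e3 := idX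
  have e4 := idY
  have e5 := idZ
  have e6 := idC
  generalize cth (lam - mu) = x at *
  generalize cth (lam - nu) = y at *
  generalize cth (mu - nu) = z at *
  generalize toM (sp12 rowA) = A12 at *
  generalize toM (sp13 rowA) = A13 at *
  generalize toM (sp23 rowA) = A23 at *
  generalize toM (sp12 rowB) = B12 at *
  generalize toM (sp13 rowB) = B13 at *
  generalize toM (sp23 rowB) = B23 at *
  simp only [add_mul, mul_add, smul_mul_assoc, mul_smul_comm, smul_add, smul_smul]
  linear_combination (norm := module) (x * z - y * z) • e1 + (y * z) • e2 + x • e3 + y • e4 + z • e5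
    + e6 + rel • (A12 * A13 - A13 * A12)
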